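/- Let α, β, γ be nonzero real numbers with θ := βγ − αγ − αβ = 0, and let s < 1/2. Then there exists T₀ > 0 such that for every T ∈ (0, T₀] and every C > 0 there exist radial functions f, g ∈ H^s(ℝ²) with ‖f‖_{H^s}, ‖g‖_{H^s} > 0 such that sup_{0 ≤ t ≤ T} ‖ ⟨ξ⟩^s D[f,g](t, ξ) ‖_{L²_ξ(ℝ²)} ≥ C ‖f‖_{H^s} ‖g‖_{H^s}, where D[f,g](t, ξ) := |ξ| ∫₀^t e^{−i(t−t′)γ|ξ|²} ( ∫_{ℝ²} e^{−it′α|η|²} f̂(η) · e^{it′β|η−ξ|²} \overline{ĝ(η−ξ)} dη ) dt′. (D[f,g] is the Fourier-side expression of the second-order Duhamel iterate ∫₀^t e^{i(t−t′)γΔ} ∇( (e^{it′αΔ}f) · \overline{(e^{it′βΔ}g)} ) dt′, up to the unimodular factor iξ/|ξ|; hence the flow map of the system cannot be C² on H^s for s < 1/2.) -/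

import Mathlib

open MeasureTheory ENNReal

noncomputable section

/-- Squared Euclidean norm on ℝ². -/
def sq2 (x : ℝ × ℝ) : ℝ := x.1 ^ 2 + x.2 ^ 2

/-- Euclidean norm on ℝ². -/
def nrm2 (x : ℝ × ℝ) : ℝ := Real.sqrt (sq2 x)

/-- Japanese bracket ⟨ξ⟩ = (1+|ξ|²)^{1/2} for ξ ∈ ℝ². -/
def jb2 (x : ℝ × ℝ) : ℝ := Real.sqrt (1 + sq2 x)

/-- Rotation of ℝ² by angle θ. -/
def rot (θ : ℝ) (x : ℝ × ℝ) : ℝ × ℝ :=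
  (Real.cos θ * x.1 - Real.sin θ * x.2, Real.sin θ * x.1 + Real.cos θ * x.2)

/-- The Fourier-side second Duhamel iterate D[f,g](t,ξ), written in terms of
the Fourier transforms F = f̂ and G = ĝ:
D(t,ξ) = |ξ| ∫₀^t e^{−i(t−t′)γ|ξ|²} ∫ e^{−it′α|η|²} F(η) e^{it′β|η−ξ|²} conj(G(η−ξ)) dη dt′. -/
def Duh (α β γ : ℝ) (F G : ℝ × ℝ → ℂ) (t : ℝ) (ξ : ℝ × ℝ) : ℂ :=
  (nrm2 ξ : ℂ) *
    ∫ t' in (0 : ℝ)..t,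
      Complex.exp (-Complex.I * (((t - t') * γ * sq2 ξ : ℝ) : ℂ)) *
        ∫ η : ℝ × ℝ,
          Complex.exp (-Complex.I * ((t' * α * sq2 η : ℝ) : ℂ)) * F η *
            Complex.exp (Complex.I * ((t' * β * sq2 (η - ξ) : ℝ) : ℂ)) *
            (starRingEnd ℂ) (G (η - ξ))

/-- The half-open annulus `R - h < |x| ≤ R + h` in ℝ². -/
def annulus (R h : ℝ) : Set (ℝ × ℝ) := {x | R - h < nrm2 x ∧ nrm2 x ≤ R + h}

lemma continuous_sq2 : Continuous sq2 := by
  unfold sq2; fun_prop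

lemma continuous_nrm2 : Continuous nrm2 :=
  Real.continuous_sqrt.comp continuous_sq2

lemma sq2_nonneg (x : ℝ × ℝ) : 0 ≤ sq2 x := by
  unfold sq2; positivity

lemma nrm2_nonneg (x : ℝ × ℝ) : 0 ≤ nrm2 x := Real.sqrt_nonneg _

lemma nrm2_sq (x : ℝ × ℝ) : nrm2 x ^ 2 = sq2 x := Real.sq_sqrt (sq2_nonneg x)

lemma nrm2_eq_norm (x : ℝ × ℝ) : nrm2 x = ‖Complex.measurableEquivRealProd.symm x‖ := by
  rw [Complex.norm_eq_sqrt_sq_add_sq]; rfl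

lemma nrm2_smul (a : ℝ) (x : ℝ × ℝ) : nrm2 (a • x) = |a| * nrm2 x := by
  have : sq2 (a • x) = a ^ 2 * sq2 x := by simp [sq2]; ring
  rw [nrm2, this, Real.sqrt_mul (sq_nonneg a), Real.sqrt_sq_eq_abs, nrm2]

lemma nrm2_add_le (x y : ℝ × ℝ) : nrm2 (x + y) ≤ nrm2 x + nrm2 y := by
  simp only [nrm2_eq_norm]
  exact norm_add_le (Complex.measurableEquivRealProd.symm x) (Complex.measurableEquivRealProd.symm y)

lemma abs_nrm2_add_sub_le (x y : ℝ × ℝ) : |nrm2 (x + y) - nrm2 y| ≤ nrm2 x := by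
  have h := nrm2_add_le (x + y) (-x)
  have h' : nrm2 (-x) = nrm2 x := by simpa using nrm2_smul (-1) x
  rw [add_neg_cancel_comm, h'] at h
  rw [abs_le]
  constructor <;> linarith [nrm2_add_le x y]

lemma nrm2_rot (θ : ℝ) (x : ℝ × ℝ) : nrm2 (rot θ x) = nrm2 x := by
  have : sq2 (rot θ x) = sq2 x := by
    simp only [sq2, rot]
    linear_combination (x.1 ^ 2 + x.2 ^ 2) * Real.sin_sq_add_cos_sq θ
  rw [nrm2, this, nrm2]

lemma measurableSet_annulus (R h : ℝ) : MeasurableSet (annulus R h) :=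
  (measurableSet_lt measurable_const continuous_nrm2.measurable).inter
    (measurableSet_le continuous_nrm2.measurable measurable_const)

lemma annulus_indicator_rot (R h θ : ℝ) (x : ℝ × ℝ) :
    (annulus R h).indicator (1 : ℝ × ℝ → ℂ) (rot θ x) = (annulus R h).indicator 1 x := by
  have : rot θ x ∈ annulus R h ↔ x ∈ annulus R h := by simp [annulus, nrm2_rot]
  by_cases hx : x ∈ annulus R h <;> simp [hx, this]

lemma volume_annulus {R h : ℝ} (hh : 0 ≤ h) (hR : h ≤ R) :
    volume (annulus R h) = ENNReal.ofReal (4 * Real.pi * R * h) := by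
  have hpre : Complex.measurableEquivRealProd ⁻¹' annulus R h =
      Metric.closedBall 0 (R + h) \ Metric.closedBall 0 (R - h) := by
    ext z
    simp [annulus, nrm2_eq_norm, and_comm]
  rw [← Complex.volume_preserving_equiv_real_prod.measure_preimage
      (measurableSet_annulus R h).nullMeasurableSet, hpre,
    measure_sdiff (Metric.closedBall_subset_closedBall (by linarith))
      measurableSet_closedBall.nullMeasurableSet (measure_closedBall_lt_top).ne,
    Complex.volume_closedBall, Complex.volume_closedBall,
    ← ENNReal.ofReal_pow (by linarith), ← ENNReal.ofReal_pow (by linarith),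
    show ((NNReal.pi : NNReal) : ENNReal) = ENNReal.ofReal Real.pi from
      (ENNReal.ofReal_coe_nnreal (p := NNReal.pi)).symm,
    ← ENNReal.ofReal_mul (by positivity), ← ENNReal.ofReal_mul (by positivity),
    ← ENNReal.ofReal_sub _ (by positivity)]
  congr 1; ring

lemma eLpNorm_annulus_indicator {R h a : ℝ} (hh : 0 ≤ h) (hR : h ≤ R) (ha : 0 ≤ a) :
    eLpNorm ((annulus R h).indicator fun _ => a) 2 volume =
      ENNReal.ofReal (a * Real.sqrt (4 * Real.pi * R * h)) := by
  have hR0 : 0 ≤ R := hh.trans hR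
  rw [eLpNorm_indicator_const (measurableSet_annulus R h) (by simp) (by simp),
    volume_annulus hh hR, Real.enorm_eq_ofReal ha, ENNReal.ofReal_mul ha, Real.sqrt_eq_rpow,
    ENNReal.ofReal_rpow_of_nonneg (by positivity) (by simp)]
  simp

lemma eLpNorm_le_of_annulus {R h a : ℝ} (hh : 0 ≤ h) (hR : h ≤ R) (ha : 0 ≤ a)
    {f : ℝ × ℝ → ℂ} (hf : ∀ x ∈ annulus R h, ‖f x‖ ≤ a) (hf0 : ∀ x ∉ annulus R h, f x = 0) :
    eLpNorm f 2 volume ≤ ENNReal.ofReal (a * Real.sqrt (4 * Real.pi * R * h)) := by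
  rw [← eLpNorm_annulus_indicator hh hR ha]
  refine eLpNorm_mono fun x => ?_
  by_cases hx : x ∈ annulus R h
  · simpa [hx, abs_of_nonneg ha] using hf x hx
  · simp [hx, hf0 x hx]

lemma le_eLpNorm_of_annulus {R h a : ℝ} (hh : 0 ≤ h) (hR : h ≤ R) (ha : 0 ≤ a)
    {f : ℝ × ℝ → ℂ} (hf : ∀ x ∈ annulus R h, a ≤ ‖f x‖) :
    ENNReal.ofReal (a * Real.sqrt (4 * Real.pi * R * h)) ≤ eLpNorm f 2 volume := by
  rw [← eLpNorm_annulus_indicator hh hR ha]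
  refine eLpNorm_mono fun x => ?_
  by_cases hx : x ∈ annulus R h
  · simpa [hx, abs_of_nonneg ha] using hf x hx
  · simp [hx]

lemma rpow_le_two_rpow_abs_mul {x R : ℝ} (s : ℝ) (hx : 0 < x) (hR : 0 < R)
    (h1 : R / 2 ≤ x) (h2 : x ≤ 2 * R) : x ^ s ≤ 2 ^ |s| * R ^ s := by
  rcases le_total 0 s with hs | hs
  · rw [abs_of_nonneg hs, ← Real.mul_rpow (by norm_num) hR.le]
    exact Real.rpow_le_rpow hx.le h2 hs
  · rw [abs_of_nonpos hs]
    calc x ^ s ≤ (R / 2) ^ s := Real.rpow_le_rpow_of_nonpos (by positivity) h1 hs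
      _ = 2 ^ (-s) * R ^ s := by
        rw [Real.div_rpow hR.le (by norm_num), Real.rpow_neg (by norm_num)]; field_simp

lemma nrm2_le_jb2 (x : ℝ × ℝ) : nrm2 x ≤ jb2 x :=
  Real.sqrt_le_sqrt (by linarith)

lemma jb2_pos (x : ℝ × ℝ) : 0 < jb2 x :=
  Real.sqrt_pos.2 (by linarith [sq2_nonneg x])

lemma jb2_le (x : ℝ × ℝ) : jb2 x ≤ 1 + nrm2 x := by
  refine Real.sqrt_le_iff.2 ⟨by linarith [nrm2_nonneg x], ?_⟩
  nlinarith [nrm2_nonneg x, nrm2_sq x]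

lemma jb2_rpow_le {R h : ℝ} (s : ℝ) (h1 : h ≤ 1) (hR : 2 ≤ R) {x : ℝ × ℝ}
    (hx : x ∈ annulus R h) : jb2 x ^ s ≤ 2 ^ |s| * R ^ s :=
  rpow_le_two_rpow_abs_mul s (jb2_pos x) (by linarith)
    (by linarith [hx.1, nrm2_le_jb2 x]) (by linarith [hx.2, jb2_le x])

lemma le_jb2_rpow {R h : ℝ} (s : ℝ) (h1 : h ≤ 1) (hR : 2 ≤ R) {x : ℝ × ℝ}
    (hx : x ∈ annulus R h) : (2 ^ |s|)⁻¹ * R ^ s ≤ jb2 x ^ s := by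
  have hJ := jb2_pos x
  have := rpow_le_two_rpow_abs_mul (-s) hJ (R := R) (by linarith)
    (by linarith [hx.1, nrm2_le_jb2 x]) (by linarith [hx.2, jb2_le x])
  have hR0 : 0 < R := by linarith
  rw [abs_neg, Real.rpow_neg hJ.le, Real.rpow_neg hR0.le] at this
  have hJs : 0 < jb2 x ^ s := Real.rpow_pos_of_pos hJ s
  have hRs : 0 < R ^ s := Real.rpow_pos_of_pos hR0 s
  have h2 : (0 : ℝ) < 2 ^ |s| := by positivity
  rw [inv_mul_le_iff₀ h2]
  rwa [← div_eq_mul_inv, inv_le_iff_one_le_mul₀ hJs, div_mul_eq_mul_div, one_le_div hRs] at this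

lemma eLpNorm_weight_annulus_le {R : ℝ} (s : ℝ) (hR : 2 ≤ R) :
    eLpNorm (fun ξ => ((jb2 ξ ^ s : ℝ) : ℂ) * (annulus R 1).indicator 1 ξ) 2 volume ≤
      ENNReal.ofReal (2 ^ |s| * R ^ s * Real.sqrt (4 * Real.pi * R)) := by
  have hR0 : 0 ≤ R := by linarith
  have := eLpNorm_le_of_annulus (R := R) (h := 1) (a := 2 ^ |s| * R ^ s)
    (f := fun ξ => ((jb2 ξ ^ s : ℝ) : ℂ) * (annulus R 1).indicator 1 ξ)
    (by norm_num) (by linarith) (by positivity) ?_ ?_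
  · simpa using this
  · intro x hx
    simpa [hx, abs_of_pos (Real.rpow_pos_of_pos (jb2_pos x) s)] using jb2_rpow_le s le_rfl hR hx
  · intro x hx
    simp [hx]

lemma eLpNorm_weight_annulus_pos {R : ℝ} (s : ℝ) (hR : 2 ≤ R) :
    0 < eLpNorm (fun ξ => ((jb2 ξ ^ s : ℝ) : ℂ) * (annulus R 1).indicator 1 ξ) 2 volume := by
  have hR0 : 0 < R := by linarith
  refine lt_of_lt_of_le ?_ (le_eLpNorm_of_annulus (R := R) (h := 1) (a := (2 ^ |s|)⁻¹ * R ^ s)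
    (by norm_num) (by linarith) (by positivity) ?_)
  · rw [ENNReal.ofReal_pos]; positivity
  · intro x hx
    simpa [hx, abs_of_pos (Real.rpow_pos_of_pos (jb2_pos x) s)] using le_jb2_rpow s le_rfl hR hx

lemma Duh_annulus_eq (α β γ κ c : ℝ)
    (hΦ : ∀ ξ η : ℝ × ℝ, γ * sq2 ξ - α * sq2 η + β * sq2 (η - ξ) = c * sq2 (η - κ • ξ))
    (R₁ R₂ T : ℝ) (ξ : ℝ × ℝ) :
    Duh α β γ ((annulus R₁ 1).indicator 1) ((annulus R₂ 1).indicator 1) T ξ =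
      (nrm2 ξ : ℂ) * (Complex.exp (((-(T * γ * sq2 ξ) : ℝ) : ℂ) * Complex.I) *
        ∫ t' in (0 : ℝ)..T, ∫ η in annulus R₁ 1 ∩ (fun η => η - ξ) ⁻¹' annulus R₂ 1,
          Complex.exp (((t' * (c * sq2 (η - κ • ξ)) : ℝ) : ℂ) * Complex.I)) := by
  have hS : MeasurableSet (annulus R₁ 1 ∩ (fun η => η - ξ) ⁻¹' annulus R₂ 1) :=
    (measurableSet_annulus R₁ 1).inter
      ((measurable_id.sub_const ξ) (measurableSet_annulus R₂ 1))
  rw [Duh]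
  congr 1
  rw [← intervalIntegral.integral_const_mul]
  congr 1
  ext t'
  rw [← integral_indicator hS, ← integral_const_mul, ← integral_const_mul]
  congr 1
  ext η
  by_cases h1 : η ∈ annulus R₁ 1
  · by_cases h2 : η - ξ ∈ annulus R₂ 1
    · simp only [Set.indicator, h1, h2, Set.mem_inter_iff, Set.mem_preimage, and_self, if_true,
        Pi.one_apply, map_one, mul_one]
      rw [← Complex.exp_add, ← Complex.exp_add, ← Complex.exp_add, ← hΦ]
      congr 1
      push_cast
      ring
    · simp [h2]
  · simp [h1]

/-- The profile `(1 - cos (T c |y|²)) / |y|²`, with value `0` at the origin. -/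
def resonantProfile (c T : ℝ) (y : ℝ × ℝ) : ℝ := (1 - Real.cos (T * (c * sq2 y))) / sq2 y

lemma resonantProfile_nonneg (c T : ℝ) (y : ℝ × ℝ) : 0 ≤ resonantProfile c T y :=
  div_nonneg (by linarith [Real.cos_le_one (T * (c * sq2 y))]) (sq2_nonneg y)

lemma im_integral_exp (c T : ℝ) (hc : c ≠ 0) (y : ℝ × ℝ) :
    (∫ t' in (0 : ℝ)..T, Complex.exp (((t' * (c * sq2 y) : ℝ) : ℂ) * Complex.I)).im =
      c⁻¹ * resonantProfile c T y := by
  have h := Complex.imCLM.intervalIntegral_comp_comm (μ := volume) (a := 0) (b := T)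
    (f := fun t' : ℝ => Complex.exp (((t' * (c * sq2 y) : ℝ) : ℂ) * Complex.I))
    (Continuous.intervalIntegrable (by fun_prop) _ _)
  simp only [Complex.imCLM_apply, Complex.exp_ofReal_mul_I_im] at h
  rw [← h]
  rcases eq_or_ne (sq2 y) 0 with h0 | h0
  · simp [h0, resonantProfile]
  · rw [intervalIntegral.integral_comp_mul_right (fun x => Real.sin x) (mul_ne_zero hc h0),
      integral_sin, resonantProfile]
    simp
    field_simp

lemma resonantProfile_le (c T : ℝ) (hc : c ≠ 0) (y : ℝ × ℝ) :
    resonantProfile c T y ≤ |c| * |T| := by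
  have h1 := Complex.abs_im_le_norm
    (∫ t' in (0 : ℝ)..T, Complex.exp (((t' * (c * sq2 y) : ℝ) : ℂ) * Complex.I))
  have h2 := intervalIntegral.norm_integral_le_of_norm_le_const (a := 0) (b := T) (C := 1)
    (f := fun t' : ℝ => Complex.exp (((t' * (c * sq2 y) : ℝ) : ℂ) * Complex.I))
    (fun x _ => (Complex.norm_exp_ofReal_mul_I _).le)
  rw [im_integral_exp c T hc, abs_mul, abs_of_nonneg (resonantProfile_nonneg c T y), abs_inv] at h1
  rw [← inv_mul_le_iff₀ (abs_pos.2 hc)]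
  simpa using h1.trans h2

lemma measurable_resonantProfile (c T : ℝ) : Measurable (resonantProfile c T) := by
  have := continuous_sq2.measurable
  unfold resonantProfile
  fun_prop

lemma integrableOn_resonantProfile (c T : ℝ) (hc : c ≠ 0) (v : ℝ × ℝ) {S : Set (ℝ × ℝ)}
    (hS : volume S < ⊤) : IntegrableOn (fun η => resonantProfile c T (η - v)) S := by
  refine Measure.integrableOn_of_bounded (M := |c| * |T|) hS.ne
    ((measurable_resonantProfile c T).comp (measurable_id.sub_const v)).aestronglyMeasurable
    (Filter.Eventually.of_forall fun η => ?_)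
  rw [Real.norm_of_nonneg (resonantProfile_nonneg c T _)]
  exact resonantProfile_le c T hc _

lemma integral_resonantProfile_pos {c T r : ℝ} (hc : c ≠ 0) (hT : 0 < T) (hr : 0 < r)
    (hr1 : T * |c| * (2 * r) ^ 2 ≤ 1) : 0 < ∫ y in annulus r r, resonantProfile c T y := by
  have hint := integrableOn_resonantProfile c T hc 0
    ((volume_annulus hr.le le_rfl).trans_lt ENNReal.ofReal_lt_top)
  simp only [sub_zero] at hint
  rw [setIntegral_pos_iff_support_of_nonneg_ae
    (Filter.Eventually.of_forall (resonantProfile_nonneg c T)) hint]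
  have hsub : annulus r r ⊆ Function.support (resonantProfile c T) := by
    rintro y ⟨hy1, hy2⟩
    have hy0 : 0 < nrm2 y := by linarith
    have hq : 0 < sq2 y := by rw [← nrm2_sq]; positivity
    have hq' : sq2 y ≤ (2 * r) ^ 2 := by
      rw [← nrm2_sq]; exact pow_le_pow_left₀ hy0.le (by linarith) 2
    have habs : |T * (c * sq2 y)| ≤ 1 := by
      rw [abs_mul, abs_mul, abs_of_pos hT, abs_of_pos hq, ← mul_assoc]
      exact (mul_le_mul_of_nonneg_left hq' (by positivity)).trans hr1
    rw [abs_le] at habs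
    have hpi := Real.pi_gt_three
    refine div_ne_zero (fun h => ?_) hq.ne'
    have := (Real.cos_eq_one_iff_of_lt_of_lt (by linarith) (by linarith)).1
      (show Real.cos (T * (c * sq2 y)) = 1 by linarith)
    exact mul_ne_zero hT.ne' (mul_ne_zero hc hq.ne') this
  rw [Set.inter_eq_self_of_subset_right hsub, volume_annulus hr.le le_rfl, ENNReal.ofReal_pos]
  positivity

lemma le_norm_Duh_annulus {α β γ κ c : ℝ} (hc : c ≠ 0)
    (hΦ : ∀ ξ η : ℝ × ℝ, γ * sq2 ξ - α * sq2 η + β * sq2 (η - ξ) = c * sq2 (η - κ • ξ))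
    {N T r : ℝ} (hN : 1 ≤ |κ| * N) (h1 : 2 * r + |κ| * r < 1)
    (h2 : 2 * r + |κ - 1| * r < 1) {ξ : ℝ × ℝ} (hξ : ξ ∈ annulus N r) :
    nrm2 ξ * (|c|⁻¹ * ∫ y in annulus r r, resonantProfile c T y) ≤
      ‖Duh α β γ ((annulus (|κ| * N) 1).indicator 1)
        ((annulus (|κ - 1| * N) 1).indicator 1) T ξ‖ := by
  rw [Duh_annulus_eq α β γ κ c hΦ, norm_mul, norm_mul, Complex.norm_exp_ofReal_mul_I, one_mul,
    Complex.norm_real, Real.norm_of_nonneg (nrm2_nonneg ξ)]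
  refine mul_le_mul_of_nonneg_left ?_ (nrm2_nonneg ξ)
  set S := annulus (|κ| * N) 1 ∩ (fun η => η - ξ) ⁻¹' annulus (|κ - 1| * N) 1 with hSdef
  have hS : MeasurableSet S := (measurableSet_annulus _ 1).inter
      ((measurable_id.sub_const ξ) (measurableSet_annulus _ 1))
  have hSvol : volume S < ⊤ := (measure_mono Set.inter_subset_left).trans_lt
    ((volume_annulus zero_le_one hN).trans_lt ENNReal.ofReal_lt_top)
  have : IsFiniteMeasure (volume.restrict S) := ⟨by simpa using hSvol⟩
  have : IsFiniteMeasure ((volume : Measure ℝ).restrict (Set.uIoc 0 T)) :=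
    ⟨by simp [Set.uIoc]⟩
  have hcont : Continuous fun p : ℝ × (ℝ × ℝ) =>
      Complex.exp (((p.1 * (c * sq2 (p.2 - κ • ξ)) : ℝ) : ℂ) * Complex.I) := by
    have := continuous_sq2
    fun_prop
  have hint : Integrable (Function.uncurry fun (t' : ℝ) (η : ℝ × ℝ) =>
      Complex.exp (((t' * (c * sq2 (η - κ • ξ)) : ℝ) : ℂ) * Complex.I))
      ((volume.restrict (Set.uIoc 0 T)).prod (volume.restrict S)) :=
    Integrable.of_bound hcont.aestronglyMeasurable 1
      (Filter.Eventually.of_forall fun p => (Complex.norm_exp_ofReal_mul_I _).le)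
  rw [intervalIntegral_integral_swap hint]
  have hK : Integrable (fun η => ∫ t' in (0 : ℝ)..T,
      Complex.exp (((t' * (c * sq2 (η - κ • ξ)) : ℝ) : ℂ) * Complex.I)) (volume.restrict S) := by
    simp only [intervalIntegral.intervalIntegral_eq_integral_uIoc]
    exact (Integrable.integral_prod_right hint).smul _
  have him : (∫ η in S, ∫ t' in (0 : ℝ)..T,
      Complex.exp (((t' * (c * sq2 (η - κ • ξ)) : ℝ) : ℂ) * Complex.I)).im =
      c⁻¹ * ∫ η in S, resonantProfile c T (η - κ • ξ) := by
    rw [← integral_const_mul, ← Complex.imCLM_apply, ← Complex.imCLM.integral_comp_comm hK]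
    simp only [Complex.imCLM_apply, im_integral_exp c T hc]
  refine le_trans ?_ (Complex.abs_im_le_norm _)
  rw [him, abs_mul, abs_inv, abs_of_nonneg
    (integral_nonneg fun η => resonantProfile_nonneg c T _)]
  refine mul_le_mul_of_nonneg_left ?_ (by positivity)
  have hshift : MeasurableSet ((fun η => η - κ • ξ) ⁻¹' annulus r r) :=
    (measurable_id.sub_const _) (measurableSet_annulus r r)
  have hsub : (fun η => η - κ • ξ) ⁻¹' annulus r r ⊆ S := by
    have key : ∀ (a : ℝ) (y : ℝ × ℝ), 2 * r + |a| * r < 1 → y - a • ξ ∈ annulus r r →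
        y ∈ annulus (|a| * N) 1 := by
      intro a y ha hy
      have e1 := abs_nrm2_add_sub_le (y - a • ξ) (a • ξ)
      rw [sub_add_cancel, nrm2_smul, abs_le] at e1
      have e2 : |a| * (N - r) ≤ |a| * nrm2 ξ := mul_le_mul_of_nonneg_left hξ.1.le (abs_nonneg a)
      have e3 : |a| * nrm2 ξ ≤ |a| * (N + r) := mul_le_mul_of_nonneg_left hξ.2 (abs_nonneg a)
      have e4 := hy.2
      constructor <;> linarith
    intro η hη
    refine ⟨key κ η h1 hη, key (κ - 1) (η - ξ) h2 ?_⟩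
    rwa [sub_smul, one_smul, sub_sub_sub_cancel_right]
  calc ∫ y in annulus r r, resonantProfile c T y
      = ∫ η in (fun η => η - κ • ξ) ⁻¹' annulus r r, resonantProfile c T (η - κ • ξ) := by
        rw [← integral_indicator (measurableSet_annulus r r), ← integral_indicator hshift,
          ← integral_sub_right_eq_self _ (κ • ξ)]
        rfl
    _ ≤ _ := setIntegral_mono_set (integrableOn_resonantProfile c T hc _ hSvol)
        (Filter.Eventually.of_forall fun η => resonantProfile_nonneg c T _)
        hsub.eventuallyLE

lemma exists_small_radius (a b d : ℝ) :
    ∃ r : ℝ, 0 < r ∧ r ≤ 1 ∧ 2 * r + a * r < 1 ∧ 2 * r + b * r < 1 ∧ d * (2 * r) ^ 2 ≤ 1 := by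
  have h (f : ℝ → ℝ) (hf : Continuous f) (h0 : f 0 = 0) :
      ∀ᶠ r in nhdsWithin 0 (Set.Ioi 0), f r < 1 :=
    (hf.continuousAt.eventually_lt_const (by simp [h0])).filter_mono nhdsWithin_le_nhds
  obtain ⟨r, hr, h1, h2, h3, h4⟩ := ((eventually_mem_nhdsWithin).and
    ((h (fun r => r) (by fun_prop) rfl).and
    ((h (fun r => 2 * r + a * r) (by fun_prop) (by simp)).and
    ((h (fun r => 2 * r + b * r) (by fun_prop) (by simp)).and
    (h (fun r => d * (2 * r) ^ 2) (by fun_prop) (by simp)))))).exists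
  exact ⟨r, hr, h1.le, h2, h3, h4.le⟩

/-- Let α, β, γ be nonzero with θ = βγ − αγ − αβ = 0 and let
s < 1/2. Then there is T₀ > 0 such that for every T ∈ (0,T₀] and every C > 0
there are radial f, g ∈ H^s(ℝ²) with positive norms such that
sup_{0≤t≤T} ‖⟨ξ⟩^s D[f,g](t,·)‖_{L²} ≥ C ‖f‖_{H^s} ‖g‖_{H^s}.
(Here f and g are described through their Fourier transforms F = f̂, G = ĝ,
and ‖f‖_{H^s} = ‖⟨ξ⟩^s f̂‖_{L²}; f is radial iff f̂ is radial.) -/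
theorem stmt17 (α β γ : ℝ) (hα : α ≠ 0) (hβ : β ≠ 0) (hγ : γ ≠ 0)
    (hθ : β * γ - α * γ - α * β = 0) (s : ℝ) (hs : s < 1 / 2) :
    ∃ T₀ > (0 : ℝ), ∀ T : ℝ, T ∈ Set.Ioc 0 T₀ → ∀ C > (0 : ℝ),
      ∃ F G : ℝ × ℝ → ℂ,
        (∀ θ' : ℝ, ∀ ξ : ℝ × ℝ, F (rot θ' ξ) = F ξ) ∧
        (∀ θ' : ℝ, ∀ ξ : ℝ × ℝ, G (rot θ' ξ) = G ξ) ∧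
        0 < eLpNorm (fun ξ : ℝ × ℝ => ((jb2 ξ ^ s : ℝ) : ℂ) * F ξ) 2 volume ∧
        eLpNorm (fun ξ : ℝ × ℝ => ((jb2 ξ ^ s : ℝ) : ℂ) * F ξ) 2 volume < ⊤ ∧
        0 < eLpNorm (fun ξ : ℝ × ℝ => ((jb2 ξ ^ s : ℝ) : ℂ) * G ξ) 2 volume ∧
        eLpNorm (fun ξ : ℝ × ℝ => ((jb2 ξ ^ s : ℝ) : ℂ) * G ξ) 2 volume < ⊤ ∧
        ENNReal.ofReal C *
            eLpNorm (fun ξ : ℝ × ℝ => ((jb2 ξ ^ s : ℝ) : ℂ) * F ξ) 2 volume *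
            eLpNorm (fun ξ : ℝ × ℝ => ((jb2 ξ ^ s : ℝ) : ℂ) * G ξ) 2 volume ≤
          ⨆ t ∈ Set.Icc (0 : ℝ) T,
            eLpNorm (fun ξ : ℝ × ℝ => ((jb2 ξ ^ s : ℝ) : ℂ) * Duh α β γ F G t ξ)
              2 volume := by
  refine ⟨1, one_pos, fun T hT C hC => ?_⟩
  have hc : β - α ≠ 0 := fun h => mul_ne_zero hα hβ (by linear_combination γ * h - hθ)
  set κ : ℝ := β / (β - α) with hκdef
  have hκ : κ ≠ 0 := div_ne_zero hβ hc
  have hκ1 : κ - 1 ≠ 0 := by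
    rw [show κ - 1 = α / (β - α) by rw [hκdef]; field_simp; ring]
    exact div_ne_zero hα hc
  have hκp : 0 < |κ| := abs_pos.2 hκ
  have hκ1p : 0 < |κ - 1| := abs_pos.2 hκ1
  have e1 : (β - α) * κ = β := mul_div_cancel₀ _ hc
  have e2 : (β - α) * κ ^ 2 = γ + β := mul_left_cancel₀ hc (by
    linear_combination ((β - α) * κ + β) * e1 - hθ)
  have hΦ : ∀ ξ η : ℝ × ℝ, γ * sq2 ξ - α * sq2 η + β * sq2 (η - ξ) =
      (β - α) * sq2 (η - κ • ξ) := by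
    intro ξ η
    simp only [sq2, Prod.fst_sub, Prod.snd_sub, Prod.smul_fst, Prod.smul_snd, smul_eq_mul]
    linear_combination (2 * (η.1 * ξ.1 + η.2 * ξ.2)) * e1 - (ξ.1 ^ 2 + ξ.2 ^ 2) * e2
  obtain ⟨r, hr, hr1, hrκ, hrκ1, hrT⟩ := exists_small_radius |κ| |κ - 1| (T * |β - α|)
  set P : ℝ := |β - α|⁻¹ * ∫ y in annulus r r, resonantProfile (β - α) T y
  have hP : 0 < P := mul_pos (inv_pos.2 (abs_pos.2 hc))
    (integral_resonantProfile_pos hc hT.1 hr hrT)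
  set K : ℝ := 2 ^ |s|
  have hK : 0 < K := by positivity
  set L : ℝ := C * (K * |κ| ^ s * √(4 * Real.pi * |κ|)) *
    (K * |κ - 1| ^ s * √(4 * Real.pi * |κ - 1|))
  set M : ℝ := K⁻¹ * P / 2 * √(4 * Real.pi * r)
  have hM : 0 < M := by positivity
  obtain ⟨N, hN2, hNκ, hNκ1, hNL⟩ : ∃ N : ℝ, 2 ≤ N ∧ 2 ≤ |κ| * N ∧ 2 ≤ |κ - 1| * N ∧
      L / M ≤ N ^ (1 / 2 - s) :=
    (((Filter.eventually_ge_atTop 2).and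
      (((Filter.tendsto_id.const_mul_atTop hκp).eventually_ge_atTop 2).and
      (((Filter.tendsto_id.const_mul_atTop hκ1p).eventually_ge_atTop 2).and
      ((tendsto_rpow_atTop (sub_pos.2 hs)).eventually_ge_atTop (L / M))))).exists)
  have hN : 0 < N := by linarith
  have hNs : 0 < N ^ s := Real.rpow_pos_of_pos hN s
  rw [Real.rpow_sub hN, ← Real.sqrt_eq_rpow, div_le_div_iff₀ hM hNs] at hNL
  refine ⟨(annulus (|κ| * N) 1).indicator 1, (annulus (|κ - 1| * N) 1).indicator 1,
    annulus_indicator_rot _ _, annulus_indicator_rot _ _,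
    eLpNorm_weight_annulus_pos s hNκ,
    (eLpNorm_weight_annulus_le s hNκ).trans_lt ENNReal.ofReal_lt_top,
    eLpNorm_weight_annulus_pos s hNκ1,
    (eLpNorm_weight_annulus_le s hNκ1).trans_lt ENNReal.ofReal_lt_top, ?_⟩
  refine le_trans ?_ (le_iSup₂ (f := fun t (_ : t ∈ Set.Icc (0 : ℝ) T) =>
    eLpNorm (fun ξ : ℝ × ℝ => ((jb2 ξ ^ s : ℝ) : ℂ) * Duh α β γ
      ((annulus (|κ| * N) 1).indicator 1) ((annulus (|κ - 1| * N) 1).indicator 1) t ξ)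
      2 volume) T ⟨hT.1.le, le_rfl⟩)
  refine le_trans ?_ (le_eLpNorm_of_annulus (R := N) (h := r) (a := K⁻¹ * N ^ s * (N / 2 * P))
    hr.le (by linarith) (by positivity) ?_)
  · refine (mul_le_mul' (mul_le_mul' le_rfl (eLpNorm_weight_annulus_le s hNκ))
      (eLpNorm_weight_annulus_le s hNκ1)).trans ?_
    rw [← ENNReal.ofReal_mul hC.le, ← ENNReal.ofReal_mul (by positivity)]
    refine ENNReal.ofReal_le_ofReal ?_
    have hsqrt : √N * √N = N := Real.mul_self_sqrt hN.le
    rw [Real.mul_rpow hκp.le hN.le, Real.mul_rpow hκ1p.le hN.le,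
      ← mul_assoc (4 * Real.pi) |κ| N, ← mul_assoc (4 * Real.pi) |κ - 1| N,
      Real.sqrt_mul (by positivity) N, Real.sqrt_mul (by positivity) N,
      show 4 * Real.pi * N * r = 4 * Real.pi * r * N by ring, Real.sqrt_mul (by positivity) N]
    calc _ = L * N ^ s * (N ^ s * (√N * √N)) := by ring
      _ ≤ √N * M * (N ^ s * (√N * √N)) := mul_le_mul_of_nonneg_right hNL (by positivity)
      _ = _ := by rw [hsqrt]; ring
  · intro ξ hξ
    rw [norm_mul, Complex.norm_real, Real.norm_of_nonneg (Real.rpow_nonneg (jb2_pos ξ).le s)]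
    have hD := le_norm_Duh_annulus hc hΦ (T := T) (by linarith) hrκ hrκ1 hξ
    have hξN : N / 2 ≤ nrm2 ξ := by linarith [hξ.1]
    exact mul_le_mul (le_jb2_rpow s hr1 hN2 hξ)
      ((mul_le_mul_of_nonneg_right hξN hP.le).trans hD) (by positivity)
      (Real.rpow_nonneg (jb2_pos ξ).le s)
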